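/- There exist a Borel subset B of [0,1]^ℕ × {0,1}^ℕ and a Borel map f : B → Δ([0,1]) such that for every exchangeable theory μ on {0,1}^ℕ and every realization x = (s_0, s_1, …) with μ(N(s_0,…,s_{n-1})) > 0 for all n, one has (p_0, p_1, …, s_0, s_1, …) ∈ B and f(p_0, p_1, …, s_0, s_1, …) = μ̄, where p_n = μ(1 | s_0,…,s_{n-1}) are the forecasts of μ over x and μ̄ ∈ Δ([0,1]) is the pushforward of μ under the limit-average map L. -/

import Mathlib

open MeasureTheory Filter

/-- The realization space Ω = {0,1}^ℕ. -/
abbrev Omega : Type := ℕ → Bool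

/-- The cylinder set N(σ) of realizations extending the partial realization σ. -/
def cyl (σ : List Bool) : Set Omega := {x | ∀ i : Fin σ.length, x i.1 = σ.get i}

/-- The partial realization (s₀, …, s_{n-1}) consisting of the first n outcomes of x. -/
def pref (x : Omega) (n : ℕ) : List Bool := List.ofFn (fun i : Fin n => x i.1)

/-- The forecast μ(1 | σ) = μ(N(σ·1))/μ(N(σ)). -/
noncomputable def forecastOne (μ : Measure Omega) (σ : List Bool) : ℝ :=
  (μ (cyl (σ ++ [true]))).toReal / (μ (cyl σ)).toReal

/-- μ is exchangeable: cylinder probabilities are invariant under permutations. -/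
def Exchangeable (μ : Measure Omega) : Prop :=
  ∀ (σ : List Bool) (π : Equiv.Perm (Fin σ.length)),
    μ (cyl σ) = μ (cyl (List.ofFn (fun i => σ.get (π i))))

/-- The limit-average map L(s₀,s₁,…) = limsup (s₀+⋯+s_{n-1})/n, valued in [0,1]. -/
noncomputable def Lmap (x : Omega) : unitInterval :=
  Set.projIcc (0 : ℝ) 1 zero_le_one
    (Filter.limsup
      (fun n : ℕ => (∑ i ∈ Finset.range n, (if x i then (1 : ℝ) else 0)) / n) atTop)

noncomputable instance : MeasurableSpace (ProbabilityMeasure unitInterval) := borel _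

section Perm

lemma exists_perm_comp_eq_of_ofFn_perm {n : ℕ} {α : Type*} [LinearOrder α] {f g : Fin n → α}
    (h : (List.ofFn f).Perm (List.ofFn g)) : ∃ π : Equiv.Perm (Fin n), g = f ∘ π := by
  have hs : f ∘ Tuple.sort f = g ∘ Tuple.sort g := by
    apply List.ofFn_injective
    refine List.Perm.eq_of_pairwise' (r := (· ≤ ·)) ?_ ?_ ?_
    · exact (Tuple.monotone_sort f).sortedLE_ofFn.pairwise
    · exact (Tuple.monotone_sort g).sortedLE_ofFn.pairwise
    · exact (Equiv.Perm.ofFn_comp_perm _ f).trans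
        (h.trans (Equiv.Perm.ofFn_comp_perm _ g).symm)
  refine ⟨(Tuple.sort g).symm.trans (Tuple.sort f), ?_⟩
  funext i
  have := congrFun hs ((Tuple.sort g).symm i)
  simpa using this.symm

lemma Exchangeable.measure_cyl_eq_of_perm {μ : Measure Omega} (hμ : Exchangeable μ)
    {σ τ : List Bool} (h : σ.Perm τ) : μ (cyl σ) = μ (cyl τ) := by
  have hlen : σ.length = τ.length := h.length_eq
  obtain ⟨π, hπ⟩ := exists_perm_comp_eq_of_ofFn_perm (n := σ.length) (f := σ.get)
    (g := fun i => τ.get (Fin.cast hlen i)) (by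
      rw [← List.ofFn_congr hlen.symm]
      simpa [List.ofFn_get] using h)
  rw [hμ σ π]
  congr 2
  have : (fun i => σ.get (π i)) = fun i => τ.get (Fin.cast hlen i) := hπ.symm
  rw [this, ← List.ofFn_congr hlen.symm, List.ofFn_get]

end Perm

section Cylinder

lemma measurableSet_cyl (σ : List Bool) : MeasurableSet (cyl σ) := by
  have : cyl σ = ⋂ i : Fin σ.length, (fun x : Omega => x i.1) ⁻¹' {σ.get i} := by
    ext x; simp [cyl]
  rw [this]
  exact MeasurableSet.iInter fun i => measurable_pi_apply _ (measurableSet_singleton _)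

lemma mem_cyl_ofFn {n : ℕ} {a : Fin n → Bool} {x : Omega} :
    x ∈ cyl (List.ofFn a) ↔ ∀ i : Fin n, x i = a i := by
  constructor
  · intro h i
    simpa using h (Fin.cast List.length_ofFn.symm i)
  · intro h i
    exact (h (Fin.cast List.length_ofFn i)).trans (List.get_ofFn a i).symm

lemma mem_cyl_append_singleton {σ : List Bool} {b : Bool} {x : Omega} :
    x ∈ cyl (σ ++ [b]) ↔ x ∈ cyl σ ∧ x σ.length = b := by
  constructor
  · intro h
    refine ⟨fun i => ?_, ?_⟩
    · have := h ⟨i.1, by simp⟩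
      simpa [List.getElem_append_left] using this
    · simpa using h ⟨σ.length, by simp⟩
  · rintro ⟨h, hb⟩ ⟨i, hi⟩
    rcases lt_or_eq_of_le (Nat.le_of_lt_succ (by simpa using hi)) with h' | rfl
    · simpa [List.getElem_append_left h'] using h ⟨i, h'⟩
    · simpa using hb

lemma measureReal_cyl_append (μ : Measure Omega) [IsFiniteMeasure μ] (σ : List Bool) :
    μ.real (cyl (σ ++ [true])) + μ.real (cyl (σ ++ [false])) = μ.real (cyl σ) := by
  rw [← measureReal_union _ (measurableSet_cyl _)]
  · congr 1
    ext x
    simp only [Set.mem_union, mem_cyl_append_singleton]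
    cases x σ.length <;> simp
  · rw [Set.disjoint_left]
    intro x h h'
    rw [mem_cyl_append_singleton] at h h'
    simp [h.2] at h'

lemma pref_succ (x : Omega) (n : ℕ) : pref x (n + 1) = pref x n ++ [x n] := by
  simp only [pref, List.ofFn_succ_last]
  simp

lemma length_pref (x : Omega) (n : ℕ) : (pref x n).length = n := by simp [pref]

lemma measure_eq_of_forall_cyl_eq {μ ν : Measure Omega} [IsFiniteMeasure μ] [IsFiniteMeasure ν]
    (h : ∀ σ, μ (cyl σ) = ν (cyl σ)) : μ = ν := by
  have key : ∀ n : ℕ, μ.map (fun (x : Omega) (i : Fin n) => x i)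
      = ν.map (fun (x : Omega) (i : Fin n) => x i) := by
    intro n
    have hm : Measurable (fun (x : Omega) (i : Fin n) => x i) := by fun_prop
    refine Measure.ext_of_singleton fun a => ?_
    rw [Measure.map_apply hm (measurableSet_singleton _),
      Measure.map_apply hm (measurableSet_singleton _)]
    convert h (List.ofFn a) using 2 <;>
    · ext x
      simp [mem_cyl_ofFn, funext_iff]
  refine IsProjectiveLimit.unique (P := fun I : Finset ℕ => ν.map I.restrict)
    (fun I => ?_) (fun I => rfl)
  have hI : ∀ i : I, (i : ℕ) < I.sup id + 1 := fun i =>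
    Nat.lt_succ_of_le (Finset.le_sup (f := id) i.2)
  have hm : Measurable (fun (x : Omega) (i : Fin (I.sup id + 1)) => x i) := by fun_prop
  have hr : Measurable
      (fun (a : Fin (I.sup id + 1) → Bool) (i : I) => a ⟨i, hI i⟩) := by fun_prop
  have := congrArg (Measure.map
    (fun (a : Fin (I.sup id + 1) → Bool) (i : I) => a ⟨i, hI i⟩)) (key (I.sup id + 1))
  rw [Measure.map_map hr hm, Measure.map_map hr hm] at this
  exact this

end Cylinder

section Uniqueness

lemma measureReal_cyl_pref_succ {μ : Measure Omega} [IsFiniteMeasure μ] {x : Omega} {n : ℕ}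
    (hx : 0 < μ (cyl (pref x n))) :
    μ.real (cyl (pref x (n + 1))) = (if x n then forecastOne μ (pref x n)
      else 1 - forecastOne μ (pref x n)) * μ.real (cyl (pref x n)) := by
  have h0 : μ.real (cyl (pref x n)) ≠ 0 :=
    (measureReal_ne_zero_iff (by finiteness)).2 hx.ne'
  have h1 : forecastOne μ (pref x n) * μ.real (cyl (pref x n))
      = μ.real (cyl (pref x n ++ [true])) := div_mul_cancel₀ _ h0
  have h2 := measureReal_cyl_append μ (pref x n)
  rw [pref_succ]
  cases hxn : x n
  · simp only [Bool.false_eq_true, if_false]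
    linarith
  · simpa using h1.symm

lemma measureReal_cyl_pref_eq {μ ν : Measure Omega} [IsProbabilityMeasure μ]
    [IsProbabilityMeasure ν] {x : Omega} (hμ : ∀ n, 0 < μ (cyl (pref x n)))
    (hν : ∀ n, 0 < ν (cyl (pref x n)))
    (h : ∀ n, forecastOne μ (pref x n) = forecastOne ν (pref x n)) (n : ℕ) :
    μ.real (cyl (pref x n)) = ν.real (cyl (pref x n)) := by
  induction n with
  | zero =>
    have : cyl (pref x 0) = Set.univ := by 
      ext y
      exact iff_of_true (fun i => absurd i.2 (by simp [pref])) trivial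
    simp [this]
  | succ n ih => rw [measureReal_cyl_pref_succ (hμ n), measureReal_cyl_pref_succ (hν n), h n, ih]

lemma perm_replicate_true_append_replicate_false (σ : List Bool) :
    σ.Perm (List.replicate (σ.count true) true ++ List.replicate (σ.count false) false) := by
  rw [List.perm_replicate_append_replicate (by simp)]
  simp [List.subset_def]

/-- A permutation-invariant additive function on partial realizations which vanishes along
one realization vanishes identically. -/
lemma eq_zero_of_forall_pref_eq_zero {d : List Bool → ℝ}
    (hperm : ∀ σ τ : List Bool, σ.Perm τ → d σ = d τ)
    (hadd : ∀ σ, d (σ ++ [true]) + d (σ ++ [false]) = d σ)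
    {x : Omega} (hx : ∀ n, d (pref x n) = 0) (σ : List Bool) : d σ = 0 := by
  obtain ⟨n, hn⟩ : ∃ n, σ.length = n := ⟨_, rfl⟩
  induction n generalizing σ with
  | zero => simpa [List.length_eq_zero_iff.1 hn, pref] using hx 0
  | succ n ih =>
    let D : ℕ → ℝ := fun j => d (List.replicate j true ++ List.replicate (n + 1 - j) false)
    have hD : ∀ τ : List Bool, τ.length = n + 1 → d τ = D (τ.count true) := by
      intro τ hτ
      have hc : τ.count false = n + 1 - τ.count true := by
        have := List.count_false_add_count_true τ
        omega
      rw [hperm _ _ (perm_replicate_true_append_replicate_false τ), hc]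
    have hstep : ∀ j ≤ n, D (j + 1) = - D j := by
      intro j hj
      have h0 := hadd (List.replicate j true ++ List.replicate (n - j) false)
      have hlen : (List.replicate j true ++ List.replicate (n - j) false).length = n := by
        simp [hj]
      rw [ih _ hlen, hD (_ ++ [true]) (by rw [List.length_append, hlen]; rfl),
        hD (_ ++ [false]) (by rw [List.length_append, hlen]; rfl)] at h0
      simp only [List.count_append, List.count_replicate, List.count_singleton] at h0
      simp at h0
      linarith
    have hpow : ∀ j ≤ n + 1, D j = (-1) ^ j * D 0 := by
      intro j
      induction j with
      | zero => simp
      | succ j ihj =>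
        intro hj
        rw [hstep j (by omega), ihj (by omega), pow_succ]
        ring
    have hle : ∀ τ : List Bool, τ.length = n + 1 → τ.count true ≤ n + 1 :=
      fun τ hτ => hτ ▸ List.count_le_length
    have hD0 : D 0 = 0 := by
      have hp := hx (n + 1)
      rw [hD _ (length_pref x _), hpow _ (hle _ (length_pref x _))] at hp
      exact (mul_eq_zero.1 hp).resolve_left (pow_ne_zero _ (by norm_num))
    rw [hD σ hn, hpow _ (hle σ hn), hD0, mul_zero]

lemma Exchangeable.eq_of_forecastOne_eq {μ ν : Measure Omega} [IsProbabilityMeasure μ]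
    [IsProbabilityMeasure ν] (eμ : Exchangeable μ) (eν : Exchangeable ν) {x : Omega}
    (hμ : ∀ n, 0 < μ (cyl (pref x n))) (hν : ∀ n, 0 < ν (cyl (pref x n)))
    (h : ∀ n, forecastOne μ (pref x n) = forecastOne ν (pref x n)) : μ = ν := by
  refine measure_eq_of_forall_cyl_eq fun σ => ?_
  have := eq_zero_of_forall_pref_eq_zero (d := fun σ => μ.real (cyl σ) - ν.real (cyl σ))
    (fun σ τ hστ => by
      simp only [Measure.real, eμ.measure_cyl_eq_of_perm hστ, eν.measure_cyl_eq_of_perm hστ])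
    (fun σ => by
      rw [← measureReal_cyl_append μ σ, ← measureReal_cyl_append ν σ]
      ring)
    (fun n => sub_eq_zero.2 (measureReal_cyl_pref_eq hμ hν h n)) σ
  exact (measureReal_eq_measureReal_iff).1 (sub_eq_zero.1 this)

end Uniqueness

section Borel

variable {X : Type*} [TopologicalSpace X] [MeasurableSpace X] [BorelSpace X]

lemma measurable_toMeasure_borel [HasOuterApproxClosed X] :
    @Measurable (ProbabilityMeasure X) (Measure X) (borel _) _
      (fun μ : ProbabilityMeasure X => (μ : Measure X)) := by
  let _ : MeasurableSpace (ProbabilityMeasure X) := borel _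
  have : BorelSpace (ProbabilityMeasure X) := ⟨rfl⟩
  refine Measurable.measure_of_isPiSystem_of_isProbabilityMeasure
    (S := {s : Set X | IsClosed s}) ?_ isPiSystem_isClosed fun F hF => ?_
  · rw [BorelSpace.measurable_eq (α := X), borel_eq_generateFrom_isClosed]
  · refine measurable_of_tendsto_metrizable
      (f := fun n (μ : ProbabilityMeasure X) => ∫⁻ x, IsClosed.apprSeq hF n x ∂μ)
      (fun n => ?_) ?_
    · exact (ProbabilityMeasure.continuous_lintegral_boundedContinuousFunction _).measurable
    · rw [tendsto_pi_nhds]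
      exact fun μ => HasOuterApproxClosed.tendsto_lintegral_apprSeq hF (μ : Measure X)

lemma polishSpace_probabilityMeasure [CompactSpace X] [TopologicalSpace.MetrizableSpace X] :
    PolishSpace (ProbabilityMeasure X) := by
  let _ := TopologicalSpace.metrizableSpaceMetric X
  let _ := TopologicalSpace.metrizableSpaceMetric (ProbabilityMeasure X)
  infer_instance

/-- On probability measures over a compact metrizable space, the σ-algebra generated by the
evaluations is the Borel σ-algebra of the weak topology. -/
lemma borelSpace_probabilityMeasure [CompactSpace X] [TopologicalSpace.MetrizableSpace X] :
    BorelSpace (ProbabilityMeasure X) := by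
  have := polishSpace_probabilityMeasure (X := X)
  let A : Set (Set X) := generateSetAlgebra (MeasurableSpace.countableGeneratingSet X)
  have hA : A.Countable :=
    countable_generateSetAlgebra MeasurableSpace.countable_countableGeneratingSet
  have hgen : ‹MeasurableSpace X› = MeasurableSpace.generateFrom A := by
    rw [generateFrom_generateSetAlgebra_eq,
      MeasurableSpace.generateFrom_countableGeneratingSet]
  have hpi : IsPiSystem A := fun s hs t ht _ => isSetAlgebra_generateSetAlgebra.inter_mem hs ht
  have : Countable A := hA
  let T : ProbabilityMeasure X → (A → ENNReal) := fun μ s => (μ : Measure X) s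
  have hmeasA : ∀ s : A, MeasurableSet (s : Set X) := fun s => by
    rw [hgen]
    exact MeasurableSpace.measurableSet_generateFrom s.2
  have hT : Measurable T :=
    measurable_pi_lambda _ fun s => (Measure.measurable_coe (hmeasA s)).comp measurable_subtype_coe
  have hinj : Function.Injective T := by
    intro μ ν h
    apply ProbabilityMeasure.toMeasure_injective
    exact ext_of_generate_finite A hgen hpi (fun s hs => congrFun h ⟨s, hs⟩) (by simp)
  refine ⟨le_antisymm ?_ ?_⟩
  · rintro s ⟨t, ht, rfl⟩
    exact measurable_toMeasure_borel ht
  · have hle : ∀ s, MeasurableSet[borel (ProbabilityMeasure X)] s →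
        ∃ t, MeasurableSet t ∧ T ⁻¹' t = s := by
      let _ : MeasurableSpace (ProbabilityMeasure X) := borel _
      have : BorelSpace (ProbabilityMeasure X) := ⟨rfl⟩
      have hT' : Measurable T := measurable_pi_lambda _ fun s =>
        (Measure.measurable_coe (hmeasA s)).comp measurable_toMeasure_borel
      intro s hs
      exact (hT'.measurableEmbedding hinj).comap_eq.ge s hs
    intro s hs
    obtain ⟨t, ht, rfl⟩ := hle s hs
    exact hT ht

lemma measurable_borel_of_measurable_toMeasure [CompactSpace X]
    [TopologicalSpace.MetrizableSpace X] {α : Type*} [MeasurableSpace α]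
    {f : α → ProbabilityMeasure X} (hf : Measurable fun a => (f a : Measure X)) :
    @Measurable _ _ _ (borel _) f := by
  rw [← (borelSpace_probabilityMeasure (X := X)).measurable_eq]
  exact hf.subtype_mk

end Borel

section Forecasts

lemma measurable_measure_cyl (σ : List Bool) :
    Measurable fun μ : ProbabilityMeasure Omega => (μ : Measure Omega) (cyl σ) :=
  (Measure.measurable_coe (measurableSet_cyl σ)).comp measurable_subtype_coe

lemma measurable_forecastOne (σ : List Bool) :
    Measurable fun μ : ProbabilityMeasure Omega => forecastOne (μ : Measure Omega) σ :=
  (measurable_measure_cyl _).ennreal_toReal.div (measurable_measure_cyl _).ennreal_toReal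

lemma measurable_comp_pref {α β : Type*} [MeasurableSpace α] [MeasurableSpace β]
    {F : α → List Bool → β} (hF : ∀ σ, Measurable fun a => F a σ) (n : ℕ) :
    Measurable fun q : α × Omega => F q.1 (pref q.2 n) := by
  have h : Measurable fun q : α × (Fin n → Bool) => F q.1 (List.ofFn q.2) :=
    measurable_from_prod_countable_left fun a => hF (List.ofFn a)
  exact h.comp (f := fun q : α × Omega => (q.1, fun i : Fin n => q.2 i)) (by fun_prop)

lemma measurableSet_exchangeable :
    MeasurableSet {μ : ProbabilityMeasure Omega | Exchangeable (μ : Measure Omega)} := by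
  simp only [Exchangeable, Set.ofPred_forall]
  exact MeasurableSet.iInter fun σ => MeasurableSet.iInter fun π =>
    measurableSet_eq_fun (measurable_measure_cyl _) (measurable_measure_cyl _)

lemma measurable_Lmap : Measurable Lmap := by
  refine continuous_projIcc.measurable.comp (Measurable.limsup fun n => ?_)
  refine Measurable.div_const (Finset.measurable_fun_sum _ fun i _ => ?_) _
  exact (measurable_of_countable fun b : Bool => if b then (1 : ℝ) else 0).comp
    (measurable_pi_apply i)

end Forecasts

/-- Corollary: there are a Borel set B ⊆ [0,1]^ℕ × {0,1}^ℕ and a Borel map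
f : B → Δ([0,1]) recovering, from the forecasts of an exchangeable theory μ along a
realization x, the pushforward μ̄ of μ under the limit-average map L. -/
theorem forecasts_determine_deFinetti_prior :
    ∃ B : Set ((ℕ → ℝ) × Omega), MeasurableSet B ∧
      ∃ f : B → ProbabilityMeasure unitInterval, Measurable f ∧
        ∀ μ : ProbabilityMeasure Omega, Exchangeable (μ : Measure Omega) →
          ∀ x : Omega, (∀ n : ℕ, 0 < (μ : Measure Omega) (cyl (pref x n))) →
            ∃ h : ((fun n => forecastOne (μ : Measure Omega) (pref x n)), x) ∈ B,
              ((f ⟨_, h⟩ : ProbabilityMeasure unitInterval) : Measure unitInterval) =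
                Measure.map Lmap (μ : Measure Omega) := by
  have := borelSpace_probabilityMeasure (X := Omega)
  have := polishSpace_probabilityMeasure (X := Omega)
  let S : Set (ProbabilityMeasure Omega × Omega) :=
    {q | Exchangeable (q.1 : Measure Omega) ∧ ∀ n, 0 < (q.1 : Measure Omega) (cyl (pref q.2 n))}
  have hS : MeasurableSet S := by
    refine (measurable_fst measurableSet_exchangeable).inter ?_
    change MeasurableSet {q : ProbabilityMeasure Omega × Omega | ∀ n, 0 < (q.1 : Measure Omega) _}
    simp only [Set.ofPred_forall]
    exact MeasurableSet.iInter fun n => measurableSet_lt measurable_const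
      (measurable_comp_pref (F := fun (μ : ProbabilityMeasure Omega) σ =>
        (μ : Measure Omega) (cyl σ)) measurable_measure_cyl n)
  let G : S → (ℕ → ℝ) × Omega := fun q =>
    (fun n => forecastOne (q.1.1 : Measure Omega) (pref q.1.2 n), q.1.2)
  have hG : Measurable G := by
    refine Measurable.prodMk (measurable_pi_lambda _ fun n => ?_)
      (measurable_snd.comp measurable_subtype_coe)
    exact (measurable_comp_pref (F := fun (μ : ProbabilityMeasure Omega) σ =>
      forecastOne (μ : Measure Omega) σ) measurable_forecastOne n).comp measurable_subtype_coe
  have hinj : Function.Injective G := by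
    rintro ⟨⟨μ, x⟩, eμ, hμ⟩ ⟨⟨ν, y⟩, eν, hν⟩ h
    obtain ⟨hp, rfl : x = y⟩ := Prod.ext_iff.1 h
    have : μ = ν := ProbabilityMeasure.toMeasure_injective
      (eμ.eq_of_forecastOne_eq eν hμ hν (congrFun hp))
    subst this
    rfl
  have := hS.standardBorel
  have hemb : MeasurableEmbedding G := hG.measurableEmbedding hinj
  let g : S → ProbabilityMeasure unitInterval := fun q =>
    q.1.1.map measurable_Lmap.aemeasurable
  have hg : Measurable g := measurable_borel_of_measurable_toMeasure
    ((Measure.measurable_map _ measurable_Lmap).comp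
      (measurable_subtype_coe.comp (measurable_fst.comp measurable_subtype_coe)))
  obtain ⟨f, hf, hfg⟩ := hemb.exists_measurable_extend hg fun _ =>
    ⟨⟨Measure.dirac 0, inferInstance⟩⟩
  refine ⟨Set.univ, MeasurableSet.univ, fun z => f z, hf.comp measurable_subtype_coe,
    fun μ eμ x hx => ⟨Set.mem_univ _, ?_⟩⟩
  exact congrArg ProbabilityMeasure.toMeasure (congrFun hfg ⟨(μ, x), eμ, hx⟩)
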